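/- Let G : [0,∞) → ℝ be continuous with compact support, and let g₀(x) = G(|x|) be the associated radially symmetric function on ℝ². Then for every x ∈ ℝ², ∫_{ℝ²} (x − y)/(2π |x − y|²) g₀(y) dy = τ₀(x), where τ₀(x) = ( |x|^{−2} ∫₀^{|x|} η G(η) dη ) x for x ≠ 0 and τ₀(0) = 0. That is, τ₀ = ∇Φ * g₀ for the two-dimensional Newtonian potential Φ. -/

import Mathlib

open MeasureTheory

/-- The radial vector field `τ₀(x) = f(|x|) x`, `f(r) = r⁻² ∫₀^r η G(η) dη` (and `τ₀(0) = 0`). -/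
noncomputable def tau0 (G : ℝ → ℝ) (x : EuclideanSpace ℝ (Fin 2)) : EuclideanSpace ℝ (Fin 2) :=
  ((‖x‖ ^ 2)⁻¹ * ∫ η in (0 : ℝ)..‖x‖, η * G η) • x

/-- Integration over `ℂ` as a radial integral of circle averages. -/
theorem integral_complex_eq_integral_circleAverage {E : Type*} [NormedAddCommGroup E]
    [NormedSpace ℝ E] {f : ℂ → E} (hf : Integrable f) :
    ∫ w, f w = ∫ r in Set.Ioi (0 : ℝ), (2 * Real.pi * r) • Real.circleAverage f 0 r := by
  have hint : IntegrableOn (fun p : ℝ × ℝ => p.1 • f (Complex.polarCoord.symm p))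
      polarCoord.target := by
    have hemb := Complex.measurableEquivRealProd.symm.measurableEmbedding
    have h1 : Integrable (fun p : ℝ × ℝ => f (Complex.measurableEquivRealProd.symm p)) :=
      (Complex.volume_preserving_equiv_real_prod.symm.integrable_comp_emb hemb).2 hf
    have h2 := (integrableOn_image_iff_integrableOn_abs_det_fderiv_smul volume
      polarCoord.open_target.measurableSet
      (fun p _ => (hasFDerivAt_polarCoord_symm p).hasFDerivWithinAt) polarCoord.symm.injOn
      (fun p : ℝ × ℝ => f (Complex.measurableEquivRealProd.symm p))).1 h1.integrableOn
    refine h2.congr_fun (fun p hp => ?_) polarCoord.open_target.measurableSet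
    have hp1 : 0 < p.1 := hp.1
    simp only [det_fderivPolarCoordSymm, abs_of_pos hp1,
      Complex.measurableEquivRealProd_symm_polarCoord_symm_apply]
  rw [← Complex.integral_comp_polarCoord_symm f]
  rw [polarCoord_target] at hint ⊢
  rw [Measure.volume_eq_prod] at hint ⊢
  rw [setIntegral_prod _ hint]
  refine setIntegral_congr_fun measurableSet_Ioi fun r _ => ?_
  have hpi := Real.pi_pos
  have hcirc (θ : ℝ) : Complex.polarCoord.symm (r, θ) = circleMap 0 r θ := by
    simp [circleMap, Complex.exp_mul_I]
  simp only [hcirc]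
  rw [integral_smul, ← integral_Ioc_eq_integral_Ioo,
    ← intervalIntegral.integral_of_le (by linarith), Real.circleAverage_eq_integral_add (-Real.pi),
    intervalIntegral.integral_comp_add_right (fun θ => f (circleMap 0 r θ)), smul_smul]
  congr 1
  · field_simp
  · congr 1 <;> ring

theorem circleAverage_inv_sub_of_lt {z : ℂ} {r : ℝ} (hr : 0 < r) (h : r < ‖z‖) :
    Real.circleAverage (fun w => (z - w)⁻¹) 0 r = z⁻¹ := by
  have hd : DiffContOnCl ℂ (fun w : ℂ => (z - w)⁻¹) (Metric.ball 0 |r|) := by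
    refine DifferentiableOn.diffContOnCl fun w hw => ?_
    have hw' : ‖w‖ ≤ r := by
      simpa [abs_of_pos hr] using Metric.closure_ball_subset_closedBall hw
    have hne : z - w ≠ 0 := by
      intro h0
      rw [sub_eq_zero.1 h0] at h
      linarith
    exact DifferentiableAt.differentiableWithinAt (by fun_prop (disch := exact hne))
  simpa using hd.circleAverage

theorem circleAverage_inv_sub_of_gt {z : ℂ} {r : ℝ} (h : ‖z‖ < r) :
    Real.circleAverage (fun w => (z - w)⁻¹) 0 r = 0 := by
  have hr : 0 < r := (norm_nonneg z).trans_lt h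
  have hd : DiffContOnCl ℂ (fun w : ℂ => w * (z * w - r)⁻¹) (Metric.ball 0 |1|) := by
    refine DifferentiableOn.diffContOnCl fun w hw => ?_
    have hw' : ‖w‖ ≤ 1 := by
      simpa using Metric.closure_ball_subset_closedBall hw
    have hne : z * w - r ≠ 0 := by
      intro h0
      have h1 : ‖z * w‖ = r := by
        rw [sub_eq_zero.1 h0, Complex.norm_real, Real.norm_of_nonneg hr.le]
      rw [norm_mul] at h1
      nlinarith [norm_nonneg z]
    exact DifferentiableAt.differentiableWithinAt (by fun_prop (disch := exact hne))
  rw [Real.circleAverage_eq_circleAverage_zero_one,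
    ← Real.circleAverage_zero_one_congr_inv (f := fun w : ℂ => (z - (r * w + 0))⁻¹)]
  have h0 := hd.circleAverage
  rw [zero_mul] at h0
  refine Eq.trans (Real.circleAverage_congr_sphere fun w hw => ?_) h0
  have hw0 : w ≠ 0 := by
    rintro rfl
    simp at hw
  have hmul : z * w - r = w * (z - r * w⁻¹) := by
    field_simp
  simp only [add_zero, hmul, mul_inv, mul_inv_cancel_left₀ hw0]

/-- The Cauchy kernel is locally integrable on `ℂ`. -/
theorem locallyIntegrable_complex_inv : LocallyIntegrable (fun w : ℂ => w⁻¹) := by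
  refine locallyIntegrable_of_norm_le_rpow (C := 1) (α := 1) ?_ ?_ ?_ ?_
  · simp
  · simp
  · exact .of_forall fun w => by simp [Real.rpow_neg_one]
  · exact measurable_inv.aestronglyMeasurable

theorem integrable_radial_mul_inv_sub {G : ℝ → ℝ} (hG : Continuous G) (hsupp : HasCompactSupport G)
    (z : ℂ) : Integrable (fun w : ℂ => G ‖w‖ • (z - w)⁻¹) := by
  obtain ⟨R, hR⟩ := hsupp.isCompact.isBounded.exists_norm_le
  have hc : HasCompactSupport (fun u : ℂ => G ‖z - u‖) := by
    refine HasCompactSupport.intro (isCompact_closedBall z R) fun u hu => ?_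
    by_contra hne
    refine hu ?_
    have := hR _ (subset_tsupport G hne)
    rwa [norm_norm, ← dist_eq_norm, dist_comm] at this
  have := (locallyIntegrable_complex_inv.integrable_smul_left_of_hasCompactSupport
    (by fun_prop) hc).comp_sub_left z
  simpa using this

/-- The Cauchy transform of a radial function on `ℂ`. -/
theorem integral_radial_mul_inv_sub {G : ℝ → ℝ} (hG : Continuous G) (hsupp : HasCompactSupport G)
    (z : ℂ) :
    ∫ w : ℂ, G ‖w‖ • (z - w)⁻¹ = (2 * Real.pi * ∫ η in (0 : ℝ)..‖z‖, η * G η) • z⁻¹ := by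
  rw [integral_complex_eq_integral_circleAverage (integrable_radial_mul_inv_sub hG hsupp z)]
  have havg (r : ℝ) (hr : 0 < r) : Real.circleAverage (fun w : ℂ => G ‖w‖ • (z - w)⁻¹) 0 r =
      G r • Real.circleAverage (fun w : ℂ => (z - w)⁻¹) 0 r := by
    rw [← Real.circleAverage_fun_smul (a := G r) (f := fun w : ℂ => (z - w)⁻¹)]
    refine Real.circleAverage_congr_sphere fun w hw => ?_
    have hw' : ‖w‖ = r := by simpa [abs_of_pos hr] using hw
    simp only [hw']
  have hae : ∀ᵐ r : ℝ, r ∈ Set.Ioi (0 : ℝ) →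
      (2 * Real.pi * r) • Real.circleAverage (fun w : ℂ => G ‖w‖ • (z - w)⁻¹) 0 r =
      (Set.Iic ‖z‖).indicator (fun r => (2 * Real.pi * (r * G r)) • z⁻¹) r := by
    filter_upwards [Measure.ae_ne volume ‖z‖] with r hne hr
    rw [havg r hr]
    rcases lt_or_gt_of_ne hne with h | h
    · rw [circleAverage_inv_sub_of_lt hr h, Set.indicator_of_mem (Set.mem_Iic.2 h.le), smul_smul,
        mul_assoc (2 * Real.pi)]
    · rw [circleAverage_inv_sub_of_gt h, Set.indicator_of_notMem (by simpa using h)]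
      simp
  rw [setIntegral_congr_ae measurableSet_Ioi hae, setIntegral_indicator measurableSet_Iic,
    Set.Ioi_inter_Iic, integral_smul_const, integral_const_mul,
    intervalIntegral.integral_of_le (norm_nonneg z)]

theorem Complex.inv_norm_sq_smul_eq_conj_inv (u : ℂ) :
    (‖u‖ ^ 2)⁻¹ • u = (starRingEnd ℂ) u⁻¹ := by
  rw [Complex.inv_def, map_mul, Complex.conj_conj, Complex.conj_ofReal, Complex.normSq_eq_norm_sq,
    mul_comm, Complex.real_smul]

/-- For `G` continuous with compact support and `g₀(x) = G(|x|)` on `ℝ²`, one has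
`(∇Φ * g₀)(x) = ∫ (x-y)/(2π|x-y|²) g₀(y) dy = τ₀(x)` for every `x`. -/
theorem gradPhi2_conv_radial_eq_tau0 (G : ℝ → ℝ) (hG : Continuous G)
    (hsupp : HasCompactSupport G) (x : EuclideanSpace ℝ (Fin 2)) :
    ∫ y : EuclideanSpace ℝ (Fin 2),
        G ‖y‖ • ((2 * Real.pi * ‖x - y‖ ^ 2)⁻¹ • (x - y)) = tau0 G x := by
  let e := Complex.orthonormalBasisOneI.repr
  obtain ⟨z, rfl⟩ := e.surjective x
  have hpt (w : ℂ) : G ‖e w‖ • ((2 * Real.pi * ‖e z - e w‖ ^ 2)⁻¹ • (e z - e w)) =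
      e ((2 * Real.pi)⁻¹ • (starRingEnd ℂ) (G ‖w‖ • (z - w)⁻¹)) := by
    rw [← map_sub, e.norm_map, e.norm_map, ← map_smul, ← map_smul, mul_inv, mul_smul,
      Complex.inv_norm_sq_smul_eq_conj_inv, smul_comm (G ‖w‖), Complex.real_smul (x := G ‖w‖),
      Complex.real_smul (x := G ‖w‖), map_mul, Complex.conj_ofReal]
  rw [← MeasureTheory.integral_comp e]
  simp only [hpt]
  have hcomm := e.toContinuousLinearEquiv.integral_comp_comm (μ := volume)
    (fun w : ℂ => (2 * Real.pi)⁻¹ • (starRingEnd ℂ) (G ‖w‖ • (z - w)⁻¹))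
  refine hcomm.trans ?_
  rw [integral_smul, integral_conj, integral_radial_mul_inv_sub hG hsupp]
  set c := ∫ η in (0 : ℝ)..‖z‖, η * G η
  have hz : (2 * Real.pi)⁻¹ • (starRingEnd ℂ) ((2 * Real.pi * c) • z⁻¹) =
      ((‖z‖ ^ 2)⁻¹ * c) • z := by
    rw [mul_comm _⁻¹ c, mul_smul c, Complex.inv_norm_sq_smul_eq_conj_inv,
      Complex.real_smul (z := z⁻¹), map_mul, Complex.conj_ofReal, ← Complex.real_smul, smul_smul,
      inv_mul_cancel_left₀ (by positivity)]
  rw [hz, tau0, e.norm_map, ← map_smul]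
  rfl
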